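/- arXiv:2110.01855 — 4 statements merged into one kernel-verified Lean document; each statement's English description precedes it below -/
import Mathlib

section
/- Let p be a prime number. For every integer k ≥ 1 one has z_{4^k} = p^{−1} · ∏_{h=0}^{2k−1} (1 − p^{−2^h}) and z_{2·4^k} = −p^{−1} · ∏_{h=0}^{2k} (1 − p^{−2^h}). -/
/-- Pairing consecutive terms: summing over `2 * m` terms at `x` reduces to `m` terms at `x ^ 2`. -/
theorem sum_range_two_mul_thueMorse_div {t : ℕ → ℤ}
    (hte : ∀ n, t (2 * n) = t n) (hto : ∀ n, t (2 * n + 1) = - t n)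
    {x : ℚ} (hx : x ≠ 0) (m : ℕ) :
    ∑ i ∈ Finset.range (2 * m), (t i : ℚ) / x ^ (2 * m - i) =
      (1 - x) * ∑ i ∈ Finset.range m, (t i : ℚ) / (x ^ 2) ^ (m - i) := by
  have pairing : ∀ (f : ℕ → ℚ) (n : ℕ), ∑ i ∈ Finset.range (2 * n), f i =
      ∑ i ∈ Finset.range n, (f (2 * i) + f (2 * i + 1)) := by
    intro f n
    induction n with
    | zero => simp
    | succ n ih =>
      rw [Nat.mul_succ, Finset.sum_range_succ, Finset.sum_range_succ, ih,
        Finset.sum_range_succ, add_assoc]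
  rw [pairing, Finset.mul_sum]
  refine Finset.sum_congr rfl fun i hi => ?_
  obtain ⟨d, rfl⟩ := Nat.exists_eq_add_of_lt (Finset.mem_range.mp hi)
  rw [hte, hto, show 2 * (i + d + 1) - 2 * i = 2 * d + 2 by omega,
    show 2 * (i + d + 1) - (2 * i + 1) = 2 * d + 1 by omega,
    show i + d + 1 - i = d + 1 by omega, ← pow_mul]
  push_cast
  field_simp
  ring

theorem sum_range_two_pow_thueMorse_div {t : ℕ → ℤ} (ht0 : t 0 = 1)
    (hte : ∀ n, t (2 * n) = t n) (hto : ∀ n, t (2 * n + 1) = - t n)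
    (n : ℕ) {x : ℚ} (hx : x ≠ 0) :
    ∑ i ∈ Finset.range (2 ^ n), (t i : ℚ) / x ^ (2 ^ n - i) =
      (-1) ^ n * x⁻¹ * ∏ h ∈ Finset.range n, (1 - (x ^ (2 ^ h))⁻¹) := by
  induction n generalizing x with
  | zero => simp [ht0]
  | succ n ih =>
    rw [pow_succ' 2 n, sum_range_two_mul_thueMorse_div hte hto hx, ih (pow_ne_zero 2 hx),
      Finset.prod_range_succ']
    simp only [← pow_mul, ← pow_succ']
    rw [pow_zero, pow_one, pow_succ (-1 : ℚ)]
    have key : (1 - x) * (x ^ 2)⁻¹ = -(x⁻¹ * (1 - x⁻¹)) := by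
      field_simp
      ring
    linear_combination
      ((-1) ^ n * ∏ h ∈ Finset.range n, (1 - (x ^ (2 ^ (h + 1)))⁻¹)) * key

theorem tm_z_product_formula (p : ℕ) [Fact p.Prime]
    (t : ℕ → ℤ) (ht0 : t 0 = 1)
    (hte : ∀ n, t (2 * n) = t n) (hto : ∀ n, t (2 * n + 1) = - t n)
    (z : ℕ → ℚ) (hz : ∀ m, z m = ∑ i ∈ Finset.range m, (t i : ℚ) / (p : ℚ) ^ (m - i)) :
    ∀ k : ℕ, 1 ≤ k →
      z (4 ^ k) = (p : ℚ)⁻¹ * ∏ h ∈ Finset.range (2 * k), (1 - ((p : ℚ) ^ (2 ^ h))⁻¹) ∧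
      z (2 * 4 ^ k) = -(p : ℚ)⁻¹ * ∏ h ∈ Finset.range (2 * k + 1), (1 - ((p : ℚ) ^ (2 ^ h))⁻¹) := by
  intro k _
  have hp : (p : ℚ) ≠ 0 := Nat.cast_ne_zero.mpr (Fact.out : p.Prime).ne_zero
  have h4 : 4 ^ k = 2 ^ (2 * k) := by rw [pow_mul]; norm_num
  constructor
  · rw [hz, h4, sum_range_two_pow_thueMorse_div ht0 hte hto _ hp]
    simp [pow_mul]
  · rw [hz, h4, ← pow_succ', sum_range_two_pow_thueMorse_div ht0 hte hto _ hp]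
    simp [pow_succ, pow_mul]
end

section
/- For every integer n ≥ 4, the longest common prefix of the Fibonacci word f and the purely periodic word (f_1 ⋯ f_{F_n})^∞ has length exactly F_{n+2} − 2; equivalently, f_{j+F_n} = f_j for all integers j with 1 ≤ j ≤ F_{n+1} − 2, while f_{F_{n+1}−1} ≠ f_{F_{n+2}−1}. -/
theorem fib_word_length (w : ℕ → List ℕ) (hw1 : w 1 = [0]) (hw2 : w 2 = [0, 1])
    (hwrec : ∀ n : ℕ, 1 ≤ n → w (n + 2) = w (n + 1) ++ w n) (m : ℕ) :
    (w (m + 1)).length = Nat.fib (m + 2) := by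
  induction m using Nat.twoStepInduction with
  | zero => simp [hw1]
  | one => simp [hw2, Nat.fib_add_two]
  | more m ih1 ih2 =>
    rw [hwrec (m + 1) (by omega), List.length_append, ih1, ih2, Nat.fib_add_two (n := m + 2),
      add_comm]

/-- Consecutive Fibonacci words commute up to a swap of the last two letters. -/
theorem fib_word_near_comm (w : ℕ → List ℕ) (hw1 : w 1 = [0]) (hw2 : w 2 = [0, 1])
    (hwrec : ∀ n : ℕ, 1 ≤ n → w (n + 2) = w (n + 1) ++ w n) (m : ℕ) :
    ∃ (p : List ℕ) (a b : ℕ), a ≠ b ∧ w (m + 2) ++ w (m + 1) = p ++ [a, b] ∧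
      w (m + 1) ++ w (m + 2) = p ++ [b, a] := by
  induction m with
  | zero => exact ⟨[0], 1, 0, by simp [hw1, hw2]⟩
  | succ m ih =>
    obtain ⟨p, a, b, hab, h1, h2⟩ := ih
    refine ⟨w (m + 2) ++ p, b, a, hab.symm, ?_, ?_⟩
    · rw [hwrec (m + 1) (by omega), List.append_assoc, h2, List.append_assoc]
    · rw [hwrec (m + 1) (by omega), h1, List.append_assoc]

theorem fib_word_repetition
    (w : ℕ → List ℕ) (hw1 : w 1 = [0]) (hw2 : w 2 = [0, 1])
    (hwrec : ∀ n : ℕ, 1 ≤ n → w (n + 2) = w (n + 1) ++ w n)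
    (f : ℕ → ℕ)
    (hf : ∀ n j : ℕ, 1 ≤ j → j ≤ (w n).length → f j = (w n).getD (j - 1) 0) :
    ∀ n : ℕ, 4 ≤ n →
      (∀ j : ℕ, 1 ≤ j → j ≤ Nat.fib (n + 1) - 2 → f (j + Nat.fib n) = f j) ∧
      f (Nat.fib (n + 1) - 1) ≠ f (Nat.fib (n + 2) - 1) := by
  intro n hn
  obtain ⟨m, rfl⟩ : ∃ m, n = m + 3 := ⟨n - 3, by omega⟩
  obtain ⟨p, a, b, hab, h1, h2⟩ := fib_word_near_comm w hw1 hw2 hwrec m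
  have hlen := fib_word_length w hw1 hw2 hwrec
  have hw3 : w (m + 3) = p ++ [a, b] := by rw [hwrec (m + 1) (by omega), h1]
  have hw4 : w (m + 4) = w (m + 2) ++ (p ++ [b, a]) := by
    rw [hwrec (m + 2) (by omega), hwrec (m + 1) (by omega), List.append_assoc, h2]
  have hl2 : (w (m + 2)).length = Nat.fib (m + 3) := hlen (m + 1)
  have hl3 : p.length + 2 = Nat.fib (m + 4) := by
    have h : (w (m + 3)).length = Nat.fib (m + 4) := hlen (m + 2)
    simpa [hw3] using h
  have hfib : Nat.fib (m + 5) = Nat.fib (m + 3) + Nat.fib (m + 4) := Nat.fib_add_two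
  have hprefix : ∀ i, i < p.length + 2 → f (i + 1) = (p ++ [a, b]).getD i 0 := fun i hi => by
    simpa [hw3] using hf (m + 3) (i + 1) (by omega) (by simp [hw3]; omega)
  have hshift : ∀ i, i < p.length + 2 →
      f (i + 1 + Nat.fib (m + 3)) = (p ++ [b, a]).getD i 0 := fun i hi => by
    rw [hf (m + 4) _ (by omega) (by simp [hw4, hl2]; omega), hw4,
      List.getD_append_right _ _ _ _ (by omega)]
    congr 1
    omega
  refine ⟨fun j hj1 hj2 => ?_, ?_⟩
  · obtain ⟨i, rfl⟩ : ∃ i, j = i + 1 := ⟨j - 1, by omega⟩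
    have hj : i + 1 ≤ Nat.fib (m + 4) - 2 := hj2
    have hi : i < p.length := by omega
    rw [hshift i (by omega), hprefix i (by omega), List.getD_append _ _ _ _ hi,
      List.getD_append _ _ _ _ hi]
  · have e1 : Nat.fib (m + 3 + 1) - 1 = p.length + 1 := by
      change Nat.fib (m + 4) - 1 = _
      omega
    have e2 : Nat.fib (m + 3 + 2) - 1 = p.length + 1 + Nat.fib (m + 3) := by
      change Nat.fib (m + 5) - 1 = _
      omega
    rw [e1, e2, hshift _ (by omega), hprefix _ (by omega),
      List.getD_append_right _ _ _ _ le_rfl, List.getD_append_right _ _ _ _ le_rfl]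
    simpa using hab
end

section
/- Let p be a prime number and let γ = (1 + √5)/2 denote the Golden Ratio. The p-adic Fibonacci number ξ_{f,p} satisfies μ(ξ_{f,p}) = γ². -/
/-- The irrationality exponent of a `p`-adic number. -/
noncomputable def irrExp (p : ℕ) [Fact p.Prime] (ξ : ℚ_[p]) : EReal :=
  sSup {e : EReal | ∃ μ : ℝ, e = (μ : EReal) ∧
    {ab : ℤ × ℤ | ab.1 ≠ 0 ∧ ab.2 ≠ 0 ∧ 0 < ‖(ab.2 : ℚ_[p]) * ξ - (ab.1 : ℚ_[p])‖ ∧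
      ‖(ab.2 : ℚ_[p]) * ξ - (ab.1 : ℚ_[p])‖ ≤
        ((max |ab.1| |ab.2| : ℤ) : ℝ) ^ (-μ)}.Infinite}

open Finset Filter Topology in
/-- A `p`-adic series with natural digits converges, and its partial sums approximate it. -/
theorem Padic.norm_tsum_sub_sum_range_le (p : ℕ) [Fact p.Prime] (d : ℕ → ℕ) (N : ℕ) :
    ‖(∑' n : ℕ, (d n : ℚ_[p]) * (p : ℚ_[p]) ^ n) - ∑ n ∈ range N, (d n : ℚ_[p]) * (p : ℚ_[p]) ^ n‖
      ≤ ((p : ℝ) ^ N)⁻¹ := by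
  have hp1 : (1 : ℝ) < p := by exact_mod_cast (Fact.out : p.Prime).one_lt
  have hterm : ∀ n, ‖(d n : ℚ_[p]) * (p : ℚ_[p]) ^ n‖ ≤ (p : ℝ)⁻¹ ^ n := by
    intro n
    rw [norm_mul, norm_pow, Padic.norm_p]
    have h1 : ‖(d n : ℚ_[p])‖ ≤ 1 := by simpa using Padic.norm_int_le_one (p := p) (d n : ℤ)
    exact mul_le_of_le_one_left (by positivity) h1
  have hsum : Summable fun n => (d n : ℚ_[p]) * (p : ℚ_[p]) ^ n :=
    Summable.of_norm_bounded
      (summable_geometric_of_lt_one (by positivity) (inv_lt_one_of_one_lt₀ hp1)) hterm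
  have htend := ((hsum.hasSum.tendsto_sum_nat).sub_const
    (∑ n ∈ range N, (d n : ℚ_[p]) * (p : ℚ_[p]) ^ n)).norm
  refine le_of_tendsto htend ?_
  filter_upwards [eventually_ge_atTop N] with M hM
  rw [← Finset.sum_Ico_eq_sub _ hM]
  refine IsUltrametricDist.norm_sum_le_of_forall_le_of_nonneg (by positivity) fun n hn => ?_
  refine (hterm n).trans ?_
  rw [← inv_pow]
  exact pow_le_pow_of_le_one (by positivity) (inv_lt_one_of_one_lt₀ hp1).le (mem_Ico.1 hn).1

/-- The archimedean lower bound for the `p`-adic absolute value of a nonzero integer. -/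
theorem Padic.inv_abs_le_norm_intCast (p : ℕ) [Fact p.Prime] {D : ℤ} (hD : D ≠ 0) :
    (|(D : ℝ)|)⁻¹ ≤ ‖(D : ℚ_[p])‖ := by
  have hp0 : (0 : ℝ) < p := by exact_mod_cast (Fact.out : p.Prime).pos
  rw [Padic.norm_eq_zpow_neg_valuation (by exact_mod_cast hD), Padic.valuation_intCast,
    zpow_neg, zpow_natCast]
  refine inv_anti₀ (by positivity) ?_
  have := Int.le_of_dvd (abs_pos.2 hD) ((dvd_abs _ _).2 (padicValInt_dvd (p := p) D))
  exact_mod_cast this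

theorem Real.abs_fib_add_two_sub_goldenRatio_sq_mul_fib_le (m : ℕ) :
    |(Nat.fib (m + 2) : ℝ) - Real.goldenRatio ^ 2 * Nat.fib m| ≤ 1 := by
  have h : (Nat.fib (m + 2) : ℝ) - Real.goldenRatio ^ 2 * Nat.fib m = Real.goldenConj ^ m := by
    rw [← Real.fib_succ_sub_goldenRatio_mul_fib, Real.goldenRatio_sq, Nat.fib_add_two]
    push_cast
    ring
  rw [h, abs_pow]
  exact pow_le_one₀ (abs_nonneg _)
    (abs_le.2 ⟨Real.neg_one_lt_goldenConj.le, Real.goldenConj_neg.le.trans zero_le_one⟩)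

/-- The integer whose base-`p` digits, least significant first, are the letters of the `m`-th
finite Fibonacci word, the word of length `fib (m + 2)`. -/
def fibWordValue (p : ℕ) : ℕ → ℤ
  | 0 => 0
  | 1 => p
  | m + 2 => fibWordValue p (m + 1) + p ^ Nat.fib (m + 3) * fibWordValue p m

theorem fibWordValue_add_two (p m : ℕ) : fibWordValue p (m + 2) =
    fibWordValue p (m + 1) + p ^ Nat.fib (m + 3) * fibWordValue p m := rfl

theorem fibWordValue_bounds {p : ℕ} (hp : 2 ≤ p) (m : ℕ) :
    (0 ≤ fibWordValue p m ∧ fibWordValue p m < (p : ℤ) ^ Nat.fib (m + 2)) ∧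
      (0 < fibWordValue p (m + 1) ∧ fibWordValue p (m + 1) < (p : ℤ) ^ Nat.fib (m + 3)) := by
  have hp' : (2 : ℤ) ≤ p := by exact_mod_cast hp
  induction m with
  | zero =>
    have h3 : Nat.fib 3 = 2 := rfl
    simp only [fibWordValue, zero_add, h3, Nat.fib_two]
    refine ⟨⟨le_rfl, by positivity⟩, by positivity, by nlinarith⟩
  | succ m ih =>
    obtain ⟨⟨h1, h2⟩, h3, h4⟩ := ih
    have hP : (0 : ℤ) < (p : ℤ) ^ Nat.fib (m + 3) := by positivity
    refine ⟨⟨h3.le, h4⟩, ?_, ?_⟩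
    · rw [fibWordValue_add_two]; positivity
    · rw [fibWordValue_add_two, show Nat.fib (m + 1 + 3) = Nat.fib (m + 2) + Nat.fib (m + 3) from
        Nat.fib_add_two, pow_add]
      nlinarith

theorem sq_mul_fibWordValue_commutator (p m : ℕ) :
    (p : ℤ) ^ 2 * ((1 - (p : ℤ) ^ Nat.fib (m + 2)) * fibWordValue p (m + 1)
        - (1 - (p : ℤ) ^ Nat.fib (m + 3)) * fibWordValue p m)
      = (-1) ^ m * (1 - p) * (p : ℤ) ^ Nat.fib (m + 4) := by
  induction m with
  | zero =>
    have h3 : Nat.fib 3 = 2 := rfl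
    have h4 : Nat.fib 4 = 3 := rfl
    simp only [fibWordValue, zero_add, h3, h4, Nat.fib_two]
    ring
  | succ m ih =>
    have h4 : Nat.fib (m + 4) = Nat.fib (m + 2) + Nat.fib (m + 3) := Nat.fib_add_two
    have h5 : Nat.fib (m + 5) = Nat.fib (m + 3) + Nat.fib (m + 4) := Nat.fib_add_two
    rw [show m + 1 + 1 = m + 2 from rfl, show m + 1 + 2 = m + 3 from rfl,
      show m + 1 + 3 = m + 4 from rfl, show m + 1 + 4 = m + 5 from rfl, h5, pow_add _ (Nat.fib (m + 3)),
      fibWordValue_add_two]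
    have h4' : (p : ℤ) ^ Nat.fib (m + 4) = p ^ Nat.fib (m + 2) * p ^ Nat.fib (m + 3) := by
      rw [h4, pow_add]
    rw [h4'] at ih ⊢
    linear_combination (-(p : ℤ) ^ Nat.fib (m + 3)) * ih

section Approximation

variable {p : ℕ} [Fact p.Prime] {ξ : ℚ_[p]}

/-- The exact quality of the approximations to the Fibonacci number by purely periodic
expansions. -/
theorem norm_fib_approximation
    (hξ : ∀ m, ‖ξ - (fibWordValue p m : ℚ_[p])‖ ≤ ((p : ℝ) ^ Nat.fib (m + 2))⁻¹) (m : ℕ) :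
    ‖((1 - (p : ℤ) ^ Nat.fib (m + 2) : ℤ) : ℚ_[p]) * ξ - (fibWordValue p m : ℚ_[p])‖
      = (p : ℝ) ^ 2 * ((p : ℝ) ^ Nat.fib (m + 4))⁻¹ := by
  have hp1 : (1 : ℝ) < p := by exact_mod_cast (Fact.out : p.Prime).one_lt
  have hp0 : (0 : ℝ) < p := by positivity
  set Δ : ℤ := (1 - (p : ℤ) ^ Nat.fib (m + 2)) * fibWordValue p (m + 1)
        - (1 - (p : ℤ) ^ Nat.fib (m + 3)) * fibWordValue p m with hΔ
  have hunit : ‖(1 - p : ℚ_[p])‖ = 1 := by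
    have hlt : ‖(-p : ℚ_[p])‖ < ‖(1 : ℚ_[p])‖ := by
      rw [norm_neg, norm_one]; exact Padic.norm_p_lt_one
    rw [sub_eq_add_neg, Padic.add_eq_max_of_ne hlt.ne', max_eq_left hlt.le, norm_one]
  have hΔn : ‖(Δ : ℚ_[p])‖ = (p : ℝ) ^ 2 * ((p : ℝ) ^ Nat.fib (m + 4))⁻¹ := by
    have h := congrArg (fun z : ℤ => ‖(z : ℚ_[p])‖) (sq_mul_fibWordValue_commutator p m)
    rw [← hΔ] at h
    push_cast at h
    rw [norm_mul, norm_mul, norm_mul, hunit, norm_pow, norm_pow, norm_pow, Padic.norm_p, norm_neg,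
      norm_one, one_pow, one_mul, one_mul, inv_pow, inv_pow] at h
    rw [← h]
    field_simp
  have h4 : Nat.fib (m + 4) = Nat.fib (m + 2) + Nat.fib (m + 3) := Nat.fib_add_two
  have hdecomp : ((1 - (p : ℤ) ^ Nat.fib (m + 2) : ℤ) : ℚ_[p]) * ξ - (fibWordValue p m : ℚ_[p])
      = (((1 - (p : ℤ) ^ Nat.fib (m + 2) : ℤ) : ℚ_[p]) * (ξ - (fibWordValue p (m + 2) : ℚ_[p]))
        + (p : ℚ_[p]) ^ Nat.fib (m + 4) * ((-fibWordValue p m : ℤ) : ℚ_[p])) + (Δ : ℚ_[p]) := by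
    rw [hΔ, h4, pow_add, fibWordValue_add_two]
    push_cast
    ring
  have herr : ‖((1 - (p : ℤ) ^ Nat.fib (m + 2) : ℤ) : ℚ_[p]) *
        (ξ - (fibWordValue p (m + 2) : ℚ_[p]))
        + (p : ℚ_[p]) ^ Nat.fib (m + 4) * ((-fibWordValue p m : ℤ) : ℚ_[p])‖
      < ‖(Δ : ℚ_[p])‖ := by
    have hlt : ((p : ℝ) ^ Nat.fib (m + 4))⁻¹ < ‖(Δ : ℚ_[p])‖ := by
      rw [hΔn]
      exact lt_mul_of_one_lt_left (by positivity) (one_lt_pow₀ hp1 two_ne_zero)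
    refine ((Padic.nonarchimedean _ _).trans (max_le ?_ ?_)).trans_lt hlt
    · rw [norm_mul]
      exact (mul_le_of_le_one_left (norm_nonneg _) (Padic.norm_int_le_one _)).trans (hξ (m + 2))
    · rw [norm_mul, norm_pow, Padic.norm_p, inv_pow]
      exact mul_le_of_le_one_right (by positivity) (Padic.norm_int_le_one _)
  rw [hdecomp, Padic.add_eq_max_of_ne herr.ne, max_eq_right herr.le, hΔn]

theorem abs_one_sub_le {P : ℤ} (hP : 1 ≤ P) : |1 - P| ≤ P := by
  rw [abs_le]; constructor <;> linarith

/-- The irrationality measure of the Fibonacci number, for pairs prime to `p`. -/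
theorem le_norm_fib_of_not_dvd
    (hξ : ∀ m, ‖ξ - (fibWordValue p m : ℚ_[p])‖ ≤ ((p : ℝ) ^ Nat.fib (m + 2))⁻¹)
    {a b : ℤ} (hab : ¬ ((p : ℤ) ∣ a ∧ (p : ℤ) ∣ b)) {M : ℝ} (hM : 1 ≤ M)
    (haM : |(a : ℝ)| ≤ M) (hbM : |(b : ℝ)| ≤ M) :
    (p : ℝ)⁻¹ * (2 * (p : ℝ) ^ 2 * M) ^ (-Real.goldenRatio ^ 2) ≤
      ‖(b : ℚ_[p]) * ξ - (a : ℚ_[p])‖ := by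
  have hpp : p.Prime := Fact.out
  have hp1 : (1 : ℝ) < p := by exact_mod_cast hpp.one_lt
  have hp0 : (0 : ℝ) < p := by positivity
  set s : ℝ := Real.goldenRatio ^ 2 with hs
  have hs2 : 2 ≤ s := by
    rw [hs, Real.goldenRatio_sq]; linarith [Real.one_lt_goldenRatio]
  set Y : ℝ := 2 * (p : ℝ) ^ 2 * M with hY
  have hpsq : (1 : ℝ) ≤ (p : ℝ) ^ 2 := one_le_pow₀ hp1.le
  have hMY : 2 * M ≤ Y := by rw [hY]; nlinarith
  have hY1 : 1 ≤ Y := by linarith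
  have hY0 : 0 < Y := by linarith
  have hex : ∃ m, Y < (p : ℝ) ^ Nat.fib (m + 3) := by
    obtain ⟨n, hn⟩ := pow_unbounded_of_one_lt Y hp1
    refine ⟨n, hn.trans_le (pow_le_pow_right₀ hp1.le ?_)⟩
    exact (Nat.le_succ n).trans (Nat.fib_add_two_strictMono.le_apply (x := n + 1))
  classical
  obtain ⟨m, hm, hQY⟩ : ∃ m, Y < (p : ℝ) ^ Nat.fib (m + 3) ∧ (p : ℝ) ^ Nat.fib (m + 2) ≤ Y := by
    refine ⟨Nat.find hex, Nat.find_spec hex, ?_⟩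
    rcases hk : Nat.find hex with _ | k
    · rw [hY, zero_add, Nat.fib_two, pow_one]; nlinarith
    · exact not_lt.1 (Nat.find_min hex (m := k) (by omega))
  have h4 : (p : ℝ) ^ Nat.fib (m + 4) = (p : ℝ) ^ Nat.fib (m + 2) * (p : ℝ) ^ Nat.fib (m + 3) := by
    rw [← pow_add, show Nat.fib (m + 4) = Nat.fib (m + 2) + Nat.fib (m + 3) from Nat.fib_add_two]
  have hE := norm_fib_approximation hξ m
  obtain ⟨⟨hX0, hXP⟩, -⟩ := fibWordValue_bounds hpp.two_le m
  set X := fibWordValue p m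
  set Q : ℝ := (p : ℝ) ^ Nat.fib (m + 2) with hQ
  have hQ0 : 0 < Q := by positivity
  set B : ℤ := 1 - (p : ℤ) ^ Nat.fib (m + 2) with hB
  have hBQ : |(B : ℝ)| ≤ Q := by
    have h : |B| ≤ (p : ℤ) ^ Nat.fib (m + 2) :=
      abs_one_sub_le (one_le_pow₀ (by exact_mod_cast hpp.one_le))
    rw [hQ]
    exact_mod_cast h
  have hXQ : |(X : ℝ)| ≤ Q := by
    have h : |X| ≤ (p : ℤ) ^ Nat.fib (m + 2) := by rw [abs_of_nonneg hX0]; exact hXP.le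
    rw [hQ]
    exact_mod_cast h
  have hYs : 0 < Y ^ (-s) := by positivity
  by_cases hD : a * B - X * b = 0
  · have hfib : Nat.fib (m + 2) ≠ 0 := (Nat.fib_pos.2 (by omega)).ne'
    have hpB : ¬ (p : ℤ) ∣ B := by
      intro h
      rw [hB, dvd_sub_left (dvd_pow_self _ hfib)] at h
      exact hpp.one_lt.ne' (by exact_mod_cast Int.eq_one_of_dvd_one (by positivity) h)
    have hpb : ¬ (p : ℤ) ∣ b := by
      intro h
      refine hab ⟨?_, h⟩
      have h' : (p : ℤ) ∣ a * B := by
        rw [sub_eq_zero.1 hD]; exact h.mul_left _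
      exact ((Nat.prime_iff_prime_int.1 hpp).dvd_or_dvd h').resolve_right hpB
    have hunit : ∀ z : ℤ, ¬ (p : ℤ) ∣ z → ‖(z : ℚ_[p])‖ = 1 := fun z hz =>
      le_antisymm (Padic.norm_int_le_one z)
        (not_lt.1 fun h => hz (Padic.norm_intCast_lt_one_iff.1 h))
    have heq : (B : ℚ_[p]) * ((b : ℚ_[p]) * ξ - a) = (b : ℚ_[p]) * ((B : ℚ_[p]) * ξ - X) := by
      have hD' : (a : ℚ_[p]) * B - X * b = 0 := by exact_mod_cast hD
      linear_combination -hD'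
    have hn := congrArg norm heq
    rw [norm_mul, norm_mul, hunit B hpB, hunit b hpb, one_mul, one_mul, hE] at hn
    rw [hn]
    have hfibs := (abs_le.1 (Real.abs_fib_add_two_sub_goldenRatio_sq_mul_fib_le (m + 2))).2
    have hupper : (p : ℝ) ^ Nat.fib (m + 4) ≤ p * Y ^ s := by
      calc (p : ℝ) ^ Nat.fib (m + 4) = (p : ℝ) ^ (Nat.fib (m + 4) : ℝ) :=
            (Real.rpow_natCast _ _).symm
        _ ≤ (p : ℝ) ^ (1 + (Nat.fib (m + 2) : ℝ) * s) := by
            refine Real.rpow_le_rpow_of_exponent_le hp1.le ?_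
            linarith [mul_comm s (Nat.fib (m + 2) : ℝ)]
        _ = p * Q ^ s := by
            rw [Real.rpow_add hp0, Real.rpow_one, Real.rpow_mul hp0.le, Real.rpow_natCast]
        _ ≤ p * Y ^ s := by gcongr
    calc (p : ℝ)⁻¹ * Y ^ (-s) = (p * Y ^ s)⁻¹ := by rw [Real.rpow_neg hY0.le, mul_inv]
      _ ≤ ((p : ℝ) ^ Nat.fib (m + 4))⁻¹ := by gcongr
      _ ≤ (p : ℝ) ^ 2 * ((p : ℝ) ^ Nat.fib (m + 4))⁻¹ :=
          le_mul_of_one_le_left (by positivity) hpsq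
  · have hDle : |((a * B - X * b : ℤ) : ℝ)| ≤ 2 * M * Q := by
      push_cast
      calc |(a : ℝ) * B - X * b| ≤ |(a : ℝ) * B| + |(X : ℝ) * b| := abs_sub _ _
        _ = |(a : ℝ)| * |(B : ℝ)| + |(X : ℝ)| * |(b : ℝ)| := by rw [abs_mul, abs_mul]
        _ ≤ M * Q + Q * M := by gcongr
        _ = 2 * M * Q := by ring
    have hDnorm : (2 * M * Q)⁻¹ ≤ ‖((a * B - X * b : ℤ) : ℚ_[p])‖ :=
      (inv_anti₀ (abs_pos.2 (by exact_mod_cast hD)) hDle).trans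
        (Padic.inv_abs_le_norm_intCast p hD)
    have hElt : ‖(B : ℚ_[p]) * ξ - X‖ < (2 * M * Q)⁻¹ := by
      rw [hE, h4, ← div_eq_mul_inv, ← one_div, div_lt_div_iff₀ (by positivity) (by positivity)]
      have := mul_lt_mul_of_pos_left hm hQ0
      rw [hY] at this
      linarith
    have hDeq : ((a * B - X * b : ℤ) : ℚ_[p]) =
        (b : ℚ_[p]) * ((B : ℚ_[p]) * ξ - X) + ((-B : ℤ) : ℚ_[p]) * ((b : ℚ_[p]) * ξ - a) := by
      push_cast; ring
    have hge : (2 * M * Q)⁻¹ ≤ ‖(b : ℚ_[p]) * ξ - (a : ℚ_[p])‖ := by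
      have hmax := Padic.nonarchimedean ((b : ℚ_[p]) * ((B : ℚ_[p]) * ξ - (X : ℚ_[p])))
        (((-B : ℤ) : ℚ_[p]) * ((b : ℚ_[p]) * ξ - (a : ℚ_[p])))
      rw [← hDeq, norm_mul, norm_mul] at hmax
      have h1 := mul_le_of_le_one_left (norm_nonneg ((B : ℚ_[p]) * ξ - (X : ℚ_[p])))
        (Padic.norm_int_le_one (p := p) b)
      have h2 := mul_le_of_le_one_left (norm_nonneg ((b : ℚ_[p]) * ξ - (a : ℚ_[p])))
        (Padic.norm_int_le_one (p := p) (-B))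
      rcases le_max_iff.1 (hDnorm.trans hmax) with h | h <;> linarith
    refine le_trans ?_ hge
    calc (p : ℝ)⁻¹ * Y ^ (-s) ≤ 1 * Y ^ (-2 : ℝ) := by
          gcongr
          · exact inv_le_one_of_one_le₀ hp1.le
      _ = (Y * Y)⁻¹ := by
          rw [one_mul, Real.rpow_neg hY0.le, Real.rpow_two, sq]
      _ ≤ (2 * M * Q)⁻¹ := by gcongr

/-- The irrationality measure of the Fibonacci number. -/
theorem le_norm_fib
    (hξ : ∀ m, ‖ξ - (fibWordValue p m : ℚ_[p])‖ ≤ ((p : ℝ) ^ Nat.fib (m + 2))⁻¹)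
    (n : ℕ) : ∀ a b : ℤ, b ≠ 0 → b.natAbs ≤ n →
    (p : ℝ)⁻¹ * (2 * (p : ℝ) ^ 2 * ((max |a| |b| : ℤ) : ℝ)) ^ (-Real.goldenRatio ^ 2) ≤
      ‖(b : ℚ_[p]) * ξ - (a : ℚ_[p])‖ := by
  have hpp : p.Prime := Fact.out
  have hp1 : (1 : ℝ) < p := by exact_mod_cast hpp.one_lt
  have hp0 : (0 : ℝ) < p := by positivity
  induction n with
  | zero => intro a b hb hbn; omega
  | succ n ih =>
    intro a b hb hbn
    have hM1 : ∀ a b : ℤ, b ≠ 0 → (1 : ℝ) ≤ ((max |a| |b| : ℤ) : ℝ) := fun a b hb => by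
      exact_mod_cast (Int.one_le_abs hb).trans (le_max_right _ _)
    by_cases hdvd : (p : ℤ) ∣ a ∧ (p : ℤ) ∣ b
    · obtain ⟨⟨a', rfl⟩, b', rfl⟩ := hdvd
      have hb' : b' ≠ 0 := right_ne_zero_of_mul hb
      have hlt : b'.natAbs ≤ n := by
        rw [Int.natAbs_mul, Int.natAbs_natCast] at hbn
        have := Int.natAbs_pos.2 hb'
        nlinarith [hpp.two_le]
      have h := ih a' b' hb' hlt
      have hM := hM1 a' b' hb'
      have hmax : ((max |(p : ℤ) * a'| |(p : ℤ) * b'| : ℤ) : ℝ) = p * ((max |a'| |b'| : ℤ) : ℝ) := by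
        rw [abs_mul, abs_mul, Nat.abs_cast, ← mul_max_of_nonneg _ _ (Int.natCast_nonneg p)]
        push_cast; rfl
      have hfac : (((p : ℤ) * b' : ℤ) : ℚ_[p]) * ξ - (((p : ℤ) * a' : ℤ) : ℚ_[p])
          = (p : ℚ_[p]) * ((b' : ℚ_[p]) * ξ - (a' : ℚ_[p])) := by
        push_cast; ring
      rw [hmax, hfac, norm_mul, Padic.norm_p]
      set M : ℝ := ((max |a'| |b'| : ℤ) : ℝ)
      have hM0 : 0 < M := by linarith
      have hpow : (p : ℝ) ^ (-Real.goldenRatio ^ 2) ≤ (p : ℝ)⁻¹ := by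
        rw [← Real.rpow_neg_one]
        refine Real.rpow_le_rpow_of_exponent_le hp1.le ?_
        rw [Real.goldenRatio_sq]; linarith [Real.goldenRatio_pos]
      calc (p : ℝ)⁻¹ * (2 * (p : ℝ) ^ 2 * (p * M)) ^ (-Real.goldenRatio ^ 2)
          = (p : ℝ) ^ (-Real.goldenRatio ^ 2) *
              ((p : ℝ)⁻¹ * (2 * (p : ℝ) ^ 2 * M) ^ (-Real.goldenRatio ^ 2)) := by
            rw [show 2 * (p : ℝ) ^ 2 * (p * M) = p * (2 * (p : ℝ) ^ 2 * M) by ring,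
              Real.mul_rpow hp0.le (by positivity)]
            ring
        _ ≤ (p : ℝ)⁻¹ * ‖(b' : ℚ_[p]) * ξ - (a' : ℚ_[p])‖ := by gcongr
    · refine le_norm_fib_of_not_dvd hξ hdvd (hM1 a b hb) ?_ ?_
      · exact_mod_cast le_max_left |a| |b|
      · exact_mod_cast le_max_right |a| |b|

theorem le_irrExp_of_lt
    (hξ : ∀ m, ‖ξ - (fibWordValue p m : ℚ_[p])‖ ≤ ((p : ℝ) ^ Nat.fib (m + 2))⁻¹)
    {μ : ℝ} (hμ0 : 0 ≤ μ) (hμ : μ < Real.goldenRatio ^ 2) : (μ : EReal) ≤ irrExp p ξ := by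
  have hpp : p.Prime := Fact.out
  have hp1 : (1 : ℝ) < p := by exact_mod_cast hpp.one_lt
  have hp0 : (0 : ℝ) < p := by positivity
  refine le_sSup ⟨μ, rfl, ?_⟩
  obtain ⟨N, hN⟩ := exists_nat_gt (3 / (Real.goldenRatio ^ 2 - μ))
  rw [div_lt_iff₀ (sub_pos.2 hμ)] at hN
  let g : ℕ → ℤ × ℤ := fun k =>
    (fibWordValue p (k + N + 1), 1 - (p : ℤ) ^ Nat.fib (k + N + 3))
  have hg : Function.Injective g := by
    intro k l hkl
    have h2 : (p : ℤ) ^ Nat.fib (k + N + 3) = (p : ℤ) ^ Nat.fib (l + N + 3) := by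
      have := congrArg Prod.snd hkl
      simp only [g] at this
      linarith
    have h3 : Nat.fib (k + N + 1 + 2) = Nat.fib (l + N + 1 + 2) :=
      Nat.pow_right_injective hpp.two_le (by exact_mod_cast h2)
    have := Nat.fib_add_two_strictMono.injective h3
    omega
  refine Set.infinite_of_injective_forall_mem hg fun k => ?_
  have hbounds := (fibWordValue_bounds hpp.two_le (k + N)).2
  have hE := norm_fib_approximation hξ (k + N + 1)
  have hPone : (1 : ℤ) < (p : ℤ) ^ Nat.fib (k + N + 3) :=
    one_lt_pow₀ (by exact_mod_cast hpp.one_lt) (Nat.fib_pos.2 (by omega)).ne'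
  have hB0 : (1 : ℤ) - (p : ℤ) ^ Nat.fib (k + N + 3) ≠ 0 := by linarith
  refine ⟨hbounds.1.ne', hB0, ?_, ?_⟩
  · exact lt_of_lt_of_eq (by positivity) hE.symm
  · refine hE.trans_le ?_
    set F := Nat.fib (k + N + 1 + 2) with hF
    have hFN : (N : ℝ) ≤ F := by
      have := Nat.fib_add_two_strictMono.le_apply (x := k + N + 1)
      exact_mod_cast (by omega : N ≤ k + N + 1).trans this
    have hfibs := (abs_le.1 (Real.abs_fib_add_two_sub_goldenRatio_sq_mul_fib_le (k + N + 1 + 2))).1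
    rw [← hF] at hfibs
    have hMle : ((max |fibWordValue p (k + N + 1)| |1 - (p : ℤ) ^ F| : ℤ) : ℝ) ≤ (p : ℝ) ^ F := by
      have h : max |fibWordValue p (k + N + 1)| |1 - (p : ℤ) ^ F| ≤ (p : ℤ) ^ F :=
        max_le (by rw [abs_of_pos hbounds.1]; exact hbounds.2.le)
          (abs_one_sub_le hPone.le)
      exact_mod_cast h
    have hMpos : (0 : ℝ) < ((max |fibWordValue p (k + N + 1)| |1 - (p : ℤ) ^ F| : ℤ) : ℝ) := by
      exact_mod_cast lt_max_of_lt_right (abs_pos.2 hB0)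
    calc (p : ℝ) ^ 2 * ((p : ℝ) ^ Nat.fib (k + N + 1 + 4))⁻¹
        = (p : ℝ) ^ (2 - (Nat.fib (k + N + 1 + 4) : ℝ)) := by
          rw [Real.rpow_sub hp0, Real.rpow_natCast, Real.rpow_two, div_eq_mul_inv]
      _ ≤ (p : ℝ) ^ ((F : ℝ) * -μ) := by
          refine Real.rpow_le_rpow_of_exponent_le hp1.le ?_
          have := mul_le_mul_of_nonneg_right hFN (sub_pos.2 hμ).le
          have h4 : (Nat.fib (k + N + 1 + 2 + 2) : ℝ) = Nat.fib (k + N + 1 + 4) := rfl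
          linarith
      _ = ((p : ℝ) ^ F) ^ (-μ) := by rw [Real.rpow_mul hp0.le, Real.rpow_natCast]
      _ ≤ _ := Real.rpow_le_rpow_of_nonpos hMpos hMle (by linarith)

theorem irrExp_fib
    (hξ : ∀ m, ‖ξ - (fibWordValue p m : ℚ_[p])‖ ≤ ((p : ℝ) ^ Nat.fib (m + 2))⁻¹) :
    irrExp p ξ = ((Real.goldenRatio ^ 2 : ℝ) : EReal) := by
  have hpp : p.Prime := Fact.out
  have hp1 : (1 : ℝ) < p := by exact_mod_cast hpp.one_lt
  have hp0 : (0 : ℝ) < p := by positivity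
  apply le_antisymm
  · refine sSup_le ?_
    rintro _ ⟨μ, rfl, hinf⟩
    rw [EReal.coe_le_coe_iff]
    by_contra! hμ
    set s : ℝ := Real.goldenRatio ^ 2 with hs
    set c : ℝ := (p : ℝ)⁻¹ * (2 * (p : ℝ) ^ 2) ^ (-s) with hc
    have hc0 : 0 < c := by positivity
    obtain ⟨K, hK⟩ := exists_nat_gt ((c⁻¹) ^ (μ - s)⁻¹)
    refine hinf (((Set.finite_Icc (-(K : ℤ)) K).prod (Set.finite_Icc (-(K : ℤ)) K)).subset ?_)
    rintro ⟨a, b⟩ ⟨-, hb, -, hle⟩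
    have hlow := (le_norm_fib hξ _ a b hb le_rfl).trans hle
    have hM1 : (1 : ℝ) ≤ ((max |a| |b| : ℤ) : ℝ) := by
      exact_mod_cast (Int.one_le_abs hb).trans (le_max_right _ _)
    dsimp only at hlow hb
    have hMK : ((max |a| |b| : ℤ) : ℝ) ≤ K := by
      set M : ℝ := ((max |a| |b| : ℤ) : ℝ)
      have hM0 : 0 < M := by linarith
      rw [Real.mul_rpow (by positivity) hM0.le, ← mul_assoc, ← hs, ← hc] at hlow
      have h1 : M ^ (μ - s) ≤ c⁻¹ := by
        rw [← one_div, le_div_iff₀ hc0]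
        calc M ^ (μ - s) * c = M ^ μ * (c * M ^ (-s)) := by
              rw [sub_eq_add_neg, Real.rpow_add hM0]; ring
          _ ≤ M ^ μ * M ^ (-μ) := by gcongr
          _ = 1 := by rw [← Real.rpow_add hM0, add_neg_cancel, Real.rpow_zero]
      have h2 : (M ^ (μ - s)) ^ (μ - s)⁻¹ ≤ (c⁻¹) ^ (μ - s)⁻¹ :=
        Real.rpow_le_rpow (by positivity) h1 (inv_nonneg.2 (sub_pos.2 hμ).le)
      rw [Real.rpow_rpow_inv hM0.le (sub_pos.2 hμ).ne'] at h2
      exact h2.trans hK.le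
    have hMK' : max |a| |b| ≤ (K : ℤ) := by exact_mod_cast hMK
    exact ⟨abs_le.1 ((le_max_left _ _).trans hMK'), abs_le.1 ((le_max_right _ _).trans hMK')⟩
  · refine le_of_forall_lt fun e he => ?_
    obtain ⟨x, hex, hx⟩ := EReal.lt_iff_exists_real_btwn.1 he
    rw [EReal.coe_lt_coe_iff] at hx
    have hpos : (0 : ℝ) < Real.goldenRatio ^ 2 := pow_pos Real.goldenRatio_pos 2
    refine hex.trans_le (le_trans ?_ (le_irrExp_of_lt hξ (le_max_right x 0) (max_lt hx hpos)))
    exact EReal.coe_le_coe_iff.2 (le_max_left x 0)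

end Approximation

theorem length_fibWord (w : ℕ → List ℕ) (hw1 : w 1 = [0]) (hw2 : w 2 = [0, 1])
    (hwrec : ∀ n : ℕ, 1 ≤ n → w (n + 2) = w (n + 1) ++ w n) (m : ℕ) :
    (w (m + 1)).length = Nat.fib (m + 2) ∧ (w (m + 2)).length = Nat.fib (m + 3) := by
  induction m with
  | zero => simp [hw1, hw2, Nat.fib_add_two]
  | succ m ih =>
    refine ⟨ih.2, ?_⟩
    rw [show m + 1 + 2 = (m + 1) + 2 from rfl, hwrec (m + 1) (by omega), List.length_append,
      show m + 1 + 1 = m + 2 from rfl, ih.1, ih.2, show m + 1 + 3 = (m + 2) + 2 from rfl,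
      Nat.fib_add_two (n := m + 2), add_comm]

open Finset in
/-- The partial sums of the Fibonacci series over the finite Fibonacci words. -/
theorem sum_range_fib_eq_fibWordValue (p : ℕ)
    (w : ℕ → List ℕ) (hw1 : w 1 = [0]) (hw2 : w 2 = [0, 1])
    (hwrec : ∀ n : ℕ, 1 ≤ n → w (n + 2) = w (n + 1) ++ w n)
    (f : ℕ → ℕ)
    (hf : ∀ n j : ℕ, 1 ≤ j → j ≤ (w n).length → f j = (w n).getD (j - 1) 0) (m : ℕ) :
    ∑ i ∈ range (Nat.fib (m + 2)), (f (i + 1) : ℤ) * (p : ℤ) ^ i = fibWordValue p m ∧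
      ∑ i ∈ range (Nat.fib (m + 3)), (f (i + 1) : ℤ) * (p : ℤ) ^ i = fibWordValue p (m + 1) := by
  have hlen := length_fibWord w hw1 hw2 hwrec
  induction m with
  | zero =>
    have h3 : Nat.fib 3 = 2 := rfl
    have f1 : f 1 = 0 := by rw [hf 2 1 le_rfl (by simp [hw2])]; simp [hw2]
    have f2 : f 2 = 1 := by rw [hf 2 2 (by omega) (by simp [hw2])]; simp [hw2]
    simp [h3, f1, f2, fibWordValue, sum_range_succ]
  | succ m ih =>
    refine ⟨ih.2, ?_⟩
    rw [show m + 1 + 3 = (m + 2) + 2 from rfl, Nat.fib_add_two, add_comm (Nat.fib (m + 2)),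
      sum_range_add, show m + 2 + 1 = m + 3 from rfl, ih.2, show m + 1 + 1 = m + 2 from rfl,
      fibWordValue_add_two, ← ih.1, mul_sum]
    congr 1
    refine sum_congr rfl fun i hi => ?_
    rw [mem_range] at hi
    have hshift : f (Nat.fib (m + 3) + i + 1) = f (i + 1) := by
      have hw := hwrec (m + 1) (by omega)
      rw [hf (m + 1 + 2) _ (by omega) (by
          rw [hw, List.length_append, (hlen m).1, show m + 1 + 1 = m + 2 from rfl, (hlen m).2]
          omega),
        hf (m + 1) (i + 1) (by omega) (by rw [(hlen m).1]; omega), hw,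
        List.getD_append_right _ _ _ _ (by
          rw [show m + 1 + 1 = m + 2 from rfl, (hlen m).2]; omega),
        show m + 1 + 1 = m + 2 from rfl, (hlen m).2]
      congr 1
      omega
    rw [hshift, pow_add]
    ring

theorem fib_irrExp (p : ℕ) [Fact p.Prime]
    (w : ℕ → List ℕ) (hw1 : w 1 = [0]) (hw2 : w 2 = [0, 1])
    (hwrec : ∀ n : ℕ, 1 ≤ n → w (n + 2) = w (n + 1) ++ w n)
    (f : ℕ → ℕ)
    (hf : ∀ n j : ℕ, 1 ≤ j → j ≤ (w n).length → f j = (w n).getD (j - 1) 0)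
    (ξ : ℚ_[p]) (hξ : ξ = ∑' n : ℕ, (f (n + 1) : ℚ_[p]) * (p : ℚ_[p]) ^ n)
    (γ : ℝ) (hγ : γ = (1 + Real.sqrt 5) / 2) :
    irrExp p ξ = ((γ ^ 2 : ℝ) : EReal) := by
  have hfib : ∀ m, ‖ξ - (fibWordValue p m : ℚ_[p])‖ ≤ ((p : ℝ) ^ Nat.fib (m + 2))⁻¹ := by
    intro m
    rw [hξ, ← (sum_range_fib_eq_fibWordValue p w hw1 hw2 hwrec f hf m).1]
    push_cast
    exact Padic.norm_tsum_sub_sum_range_le p (fun n => f (n + 1)) _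
  rw [hγ]
  exact irrExp_fib hfib
end

section
/- Let p be a prime number and let γ = (1 + √5)/2 denote the Golden Ratio. The p-adic Fibonacci number ξ_{f,p} satisfies μ×(ξ_{f,p}) ≥ γ² + 1/(1 + γ²) and μ̂×(ξ_{f,p}) ≥ 2 + 1/(2γ). -/
open Filter

/-- The multiplicative irrationality exponent of a `p`-adic number. -/
noncomputable def multIrrExp (p : ℕ) [Fact p.Prime] (ξ : ℚ_[p]) : EReal :=
  sSup {e : EReal | ∃ μ : ℝ, e = (μ : EReal) ∧
    {ab : ℤ × ℤ | 0 < ‖(ab.2 : ℚ_[p]) * ξ - (ab.1 : ℚ_[p])‖ ∧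
      ‖(ab.2 : ℚ_[p]) * ξ - (ab.1 : ℚ_[p])‖ ≤ ((|ab.1 * ab.2| : ℤ) : ℝ) ^ (-μ / 2)}.Infinite}

/-- The uniform multiplicative irrationality exponent of a `p`-adic number. -/
noncomputable def uniformMultIrrExp (p : ℕ) [Fact p.Prime] (ξ : ℚ_[p]) : EReal :=
  sSup {e : EReal | ∃ μ : ℝ, e = (μ : EReal) ∧
    ∀ᶠ X : ℝ in atTop, ∃ a b : ℤ,
      0 < ((|a * b| : ℤ) : ℝ) ^ (1 / 2 : ℝ) ∧
      ((|a * b| : ℤ) : ℝ) ^ (1 / 2 : ℝ) ≤ X ∧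
      ‖(b : ℚ_[p]) * ξ - (a : ℚ_[p])‖ ≤ X ^ (-μ)}

/-- The integer whose base `p` digits, least significant first, form the finite Fibonacci word of
length `Nat.fib (n + 2)`. -/
def fibWordVal (p : ℕ) : ℕ → ℤ
  | 0 => 0
  | 1 => p
  | n + 2 => fibWordVal p (n + 1) + (p : ℤ) ^ Nat.fib (n + 3) * fibWordVal p n

lemma fibWordVal_nonneg_and_lt {p : ℕ} (hp : 1 < p) (n : ℕ) :
    0 ≤ fibWordVal p n ∧ fibWordVal p n + 1 ≤ (p : ℤ) ^ Nat.fib (n + 2) := by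
  have hp' : (1 : ℤ) < p := by exact_mod_cast hp
  induction n using Nat.twoStepInduction with
  | zero => simp [fibWordVal]; omega
  | one =>
    have : Nat.fib 3 = 2 := rfl
    simp only [fibWordVal, Nat.reduceAdd, this]
    constructor <;> nlinarith
  | more n ih1 ih2 =>
    have h0 : (0 : ℤ) < (p : ℤ) ^ Nat.fib (n + 3) := by positivity
    have hf : Nat.fib (n + 2 + 2) = Nat.fib (n + 3) + Nat.fib (n + 2) := by
      rw [Nat.fib_add_two, add_comm]
    simp only [fibWordVal, hf, pow_add]
    have h3 : fibWordVal p (n + 1) + 1 ≤ (p : ℤ) ^ Nat.fib (n + 3) := ih2.2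
    constructor
    · have := mul_nonneg h0.le ih1.1
      linarith [ih2.1]
    · nlinarith [mul_le_mul_of_nonneg_left ih1.2 h0.le]

lemma sq_dvd_fibWordVal_succ_sub (p n : ℕ) : (p : ℤ) ^ 2 ∣ fibWordVal p (n + 1) - p := by
  induction n with
  | zero => simp [fibWordVal]
  | succ n ih =>
    have h2 : 2 ≤ Nat.fib (n + 3) := Nat.fib_mono (show 3 ≤ n + 3 by omega)
    have : fibWordVal p (n + 1 + 1) - p
        = (fibWordVal p (n + 1) - p) + (p : ℤ) ^ Nat.fib (n + 3) * fibWordVal p n := by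
      simp only [fibWordVal]; ring
    rw [this]
    exact dvd_add ih (Dvd.dvd.mul_right (pow_dvd_pow _ h2) _)

lemma not_sq_dvd_fibWordVal_succ {p : ℕ} (hp : 1 < p) (n : ℕ) :
    ¬ (p : ℤ) ^ 2 ∣ fibWordVal p (n + 1) := by
  intro h
  have h1 : (p : ℤ) ^ 2 ∣ p := by
    have := dvd_sub h (sq_dvd_fibWordVal_succ_sub p n)
    simpa using this
  have h2 := Int.le_of_dvd (by omega) h1
  have : (1 : ℤ) < p := by exact_mod_cast hp
  nlinarith

lemma fibWordVal_succ_ne_zero {p : ℕ} (hp : 1 < p) (n : ℕ) : fibWordVal p (n + 1) ≠ 0 := fun h =>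
  not_sq_dvd_fibWordVal_succ hp n (h ▸ dvd_zero _)

lemma sq_mul_fibWordVal_det (p n : ℕ) :
    (p : ℤ) ^ 2 * (fibWordVal p (n + 1) * (1 - (p : ℤ) ^ Nat.fib (n + 2))
      - fibWordVal p n * (1 - (p : ℤ) ^ Nat.fib (n + 3)))
      = (-1) ^ n * (1 - p) * (p : ℤ) ^ Nat.fib (n + 4) := by
  induction n with
  | zero =>
    have h4 : Nat.fib 4 = 3 := rfl
    simp [fibWordVal, h4]; ring
  | succ n ih =>
    have h4 : Nat.fib (n + 4) = Nat.fib (n + 2) + Nat.fib (n + 3) := Nat.fib_add_two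
    have h5 : Nat.fib (n + 1 + 4) = Nat.fib (n + 3) + Nat.fib (n + 4) := Nat.fib_add_two
    rw [h5, show n + 1 + 3 = n + 4 from rfl, show n + 1 + 2 = n + 3 from rfl, h4]
    rw [h4] at ih
    simp only [fibWordVal, pow_add (p : ℤ), pow_succ (-1 : ℤ)] at ih ⊢
    linear_combination (-(p : ℤ) ^ Nat.fib (n + 3)) * ih

lemma Nat.ofDigits_eq_sum_getD (p : ℕ) (l : List ℕ) :
    Nat.ofDigits p l = ∑ i ∈ Finset.range l.length, l.getD i 0 * p ^ i := by
  induction l with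
  | nil => simp
  | cons a l ih =>
    rw [Nat.ofDigits_cons, ih, List.length_cons, Finset.sum_range_succ', Finset.mul_sum]
    simp only [List.getD_cons_succ, List.getD_cons_zero, pow_zero, mul_one]
    rw [add_comm]
    congr 1
    exact Finset.sum_congr rfl fun i _ => by ring

section Approximation

variable {p : ℕ} [Fact p.Prime]

lemma padicNorm_one_sub_pow {k : ℕ} (hk : 0 < k) : ‖(1 : ℚ_[p]) - (p : ℚ_[p]) ^ k‖ = 1 := by
  have h : ‖-(p : ℚ_[p]) ^ k‖ < 1 := by
    rw [norm_neg, norm_pow]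
    exact pow_lt_one₀ (norm_nonneg _) Padic.norm_p_lt_one hk.ne'
  rw [sub_eq_add_neg, Padic.add_eq_max_of_ne, norm_one, max_eq_left h.le]
  rw [norm_one]
  exact h.ne'

lemma padicNorm_tsum_sub_sum_range_le (c : ℕ → ℕ) (k : ℕ) :
    ‖(∑' n, (c n : ℚ_[p]) * (p : ℚ_[p]) ^ n)
        - ∑ n ∈ Finset.range k, (c n : ℚ_[p]) * (p : ℚ_[p]) ^ n‖
      ≤ (p : ℝ) ^ (-(k : ℤ)) := by
  have hp1 : (1 : ℝ) < p := by exact_mod_cast (Fact.out : p.Prime).one_lt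
  have hterm : ∀ n, ‖(c n : ℚ_[p]) * (p : ℚ_[p]) ^ n‖ ≤ (p : ℝ)⁻¹ ^ n := fun n => by
    rw [norm_mul, norm_pow, Padic.norm_p]
    exact mul_le_of_le_one_left (by positivity) (by exact_mod_cast Padic.norm_int_le_one (c n))
  have hs : Summable fun n => (c n : ℚ_[p]) * (p : ℚ_[p]) ^ n :=
    Summable.of_norm_bounded
      (summable_geometric_of_lt_one (by positivity) (inv_lt_one_of_one_lt₀ hp1)) hterm
  rw [← hs.sum_add_tsum_nat_add k, add_sub_cancel_left]
  refine IsUltrametricDist.norm_tsum_le_of_forall_le_of_nonneg (by positivity) fun i => ?_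
  refine (hterm _).trans ?_
  rw [zpow_neg, zpow_natCast, ← inv_pow]
  exact pow_le_pow_of_le_one (by positivity) (inv_le_one_of_one_le₀ hp1.le) (Nat.le_add_left _ _)

/-- The linear form in `ξ` attached to the purely periodic word with period the finite Fibonacci
word of length `Nat.fib (n + 2)`. -/
noncomputable def fibForm (ξ : ℚ_[p]) (n : ℕ) : ℚ_[p] :=
  (1 - (p : ℚ_[p]) ^ Nat.fib (n + 2)) * ξ - fibWordVal p n

lemma one_lt_prime_cast : (1 : ℝ) < p := by exact_mod_cast (Fact.out : p.Prime).one_lt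

lemma norm_fibForm {ξ : ℚ_[p]} (h0 : ‖ξ‖ ≤ 1)
    (h : ∀ n, ‖ξ - fibWordVal p n‖ ≤ (p : ℝ) ^ (-(Nat.fib (n + 2) : ℤ))) (n : ℕ) :
    ‖fibForm ξ n‖ = (p : ℝ) ^ (2 - (Nat.fib (n + 4) : ℤ)) := by
  have hp1 : (1 : ℝ) < p := one_lt_prime_cast
  have hp0 : (p : ℚ_[p]) ≠ 0 := by exact_mod_cast (Fact.out : p.Prime).ne_zero
  have hfib : ∀ n, 0 < Nat.fib (n + 2) := fun n => Nat.fib_pos.2 (by omega)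
  have hcoarse : ∀ n, ‖fibForm ξ n‖ ≤ (p : ℝ) ^ (-(Nat.fib (n + 2) : ℤ)) := fun n => by
    have : fibForm ξ n = (ξ - fibWordVal p n) + -((p : ℚ_[p]) ^ Nat.fib (n + 2) * ξ) := by
      rw [fibForm]; ring
    rw [this]
    refine (Padic.nonarchimedean _ _).trans (max_le (h n) ?_)
    rw [norm_neg, norm_mul, Padic.norm_p_pow]
    exact mul_le_of_le_one_right (by positivity) h0
  let E : ℕ → ℚ_[p] := fun n => (-1) ^ n * (1 - p) * (p : ℚ_[p]) ^ (-2 + (Nat.fib (n + 4) : ℤ))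
  have hE : ∀ n, ‖E n‖ = (p : ℝ) ^ (2 - (Nat.fib (n + 4) : ℤ)) := fun n => by
    have h1 : ‖(1 : ℚ_[p]) - p‖ = 1 := by simpa using padicNorm_one_sub_pow (p := p) one_pos
    simp only [E, norm_mul, norm_pow, norm_neg, norm_one, one_pow, one_mul, h1,
      Padic.norm_p_zpow]
    congr 1; ring
  have hrec : ∀ n, (1 - (p : ℚ_[p]) ^ Nat.fib (n + 3)) * fibForm ξ n
      = E n + (1 - (p : ℚ_[p]) ^ Nat.fib (n + 2)) * fibForm ξ (n + 1) := fun n => by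
    have hd := congrArg (Int.cast : ℤ → ℚ_[p]) (sq_mul_fibWordVal_det p n)
    push_cast at hd
    have hE2 : (p : ℚ_[p]) ^ 2 * E n = (-1) ^ n * (1 - p) * (p : ℚ_[p]) ^ Nat.fib (n + 4) := by
      simp only [E]
      rw [zpow_add₀ hp0, zpow_natCast, zpow_neg]
      have : (p : ℚ_[p]) ^ 2 * ((p : ℚ_[p]) ^ (2 : ℤ))⁻¹ = 1 := by
        rw [show (2 : ℤ) = ((2 : ℕ) : ℤ) from rfl, zpow_natCast]
        exact mul_inv_cancel₀ (pow_ne_zero _ hp0)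
      linear_combination ((-1) ^ n * (1 - (p : ℚ_[p])) * (p : ℚ_[p]) ^ Nat.fib (n + 4)) * this
    apply mul_left_cancel₀ (pow_ne_zero 2 hp0)
    simp only [fibForm]
    rw [show n + 1 + 2 = n + 3 from rfl]
    linear_combination hd - hE2
  have hnorm : ∀ n, ‖fibForm ξ n‖
      = ‖E n + (1 - (p : ℚ_[p]) ^ Nat.fib (n + 2)) * fibForm ξ (n + 1)‖ := fun n => by
    rw [← hrec, norm_mul, padicNorm_one_sub_pow (hfib (n + 1)), one_mul]
  have hle : ∀ n, ‖fibForm ξ n‖ ≤ max ‖E n‖ ‖fibForm ξ (n + 1)‖ := fun n => by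
    rw [hnorm]
    refine (Padic.nonarchimedean _ _).trans_eq ?_
    rw [norm_mul (1 - (p : ℚ_[p]) ^ _), padicNorm_one_sub_pow (hfib n), one_mul]
  have hlt : ∀ n, Nat.fib (n + 4) < Nat.fib (n + 5) := fun n =>
    Nat.fib_lt_fib_succ (by omega)
  have hbound : ∀ n, ‖fibForm ξ n‖ ≤ ‖E n‖ := fun n => by
    refine (hle n).trans (max_le le_rfl ((hle (n + 1)).trans (max_le ?_ ?_)))
    · rw [hE, hE]
      apply zpow_le_zpow_right₀ hp1.le
      have := hlt n
      rw [show n + 1 + 4 = n + 5 from rfl]; omega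
    · refine (hcoarse (n + 2)).trans ?_
      rw [hE]
      apply zpow_le_zpow_right₀ hp1.le
      rw [show n + 2 + 2 = n + 4 from rfl]; omega
  have hsmall : ‖(1 - (p : ℚ_[p]) ^ Nat.fib (n + 2)) * fibForm ξ (n + 1)‖ < ‖E n‖ := by
    rw [norm_mul, padicNorm_one_sub_pow (hfib n), one_mul]
    refine (hbound (n + 1)).trans_lt ?_
    rw [hE, hE]
    apply zpow_lt_zpow_right₀ hp1
    have := hlt n
    rw [show n + 1 + 4 = n + 5 from rfl]; omega
  rw [hnorm, Padic.add_eq_max_of_ne hsmall.ne', max_eq_left hsmall.le, hE]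

/-- The integer paired with `1 - p ^ Nat.fib (n + 1)` in the approximation to `ξ` by an eventually
periodic word with preperiod of length `Nat.fib (n + 2)` and period of length `Nat.fib (n + 1)`. -/
def fibNumer (p n : ℕ) : ℤ := fibWordVal p (n + 1) - (p : ℤ) ^ Nat.fib (n + 1) * fibWordVal p n

lemma norm_fibNumer_approx {ξ : ℚ_[p]} (h0 : ‖ξ‖ ≤ 1)
    (h : ∀ n, ‖ξ - fibWordVal p n‖ ≤ (p : ℝ) ^ (-(Nat.fib (n + 2) : ℤ))) (n : ℕ) :
    ‖(1 - (p : ℚ_[p]) ^ Nat.fib (n + 1)) * ξ - fibNumer p n‖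
      = (p : ℝ) ^ (2 - 2 * (Nat.fib (n + 3) : ℤ)) := by
  have hp1 : (1 : ℝ) < p := one_lt_prime_cast
  have h3 : Nat.fib (n + 3) = Nat.fib (n + 1) + Nat.fib (n + 2) := Nat.fib_add_two
  have h4 : Nat.fib (n + 4) = Nat.fib (n + 2) + Nat.fib (n + 3) := Nat.fib_add_two
  have h5 : Nat.fib (n + 1 + 4) = Nat.fib (n + 3) + Nat.fib (n + 4) := Nat.fib_add_two
  have hpos : 0 < Nat.fib (n + 2) := Nat.fib_pos.2 (by omega)
  have e : (1 - (p : ℚ_[p]) ^ Nat.fib (n + 1)) * ξ - fibNumer p n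
      = -((p : ℚ_[p]) ^ Nat.fib (n + 1) * fibForm ξ n) + fibForm ξ (n + 1) := by
    simp only [fibForm, fibNumer]
    rw [show n + 1 + 2 = n + 3 from rfl, h3, pow_add]
    push_cast
    ring
  have hn : ‖-((p : ℚ_[p]) ^ Nat.fib (n + 1) * fibForm ξ n)‖
      = (p : ℝ) ^ (2 - 2 * (Nat.fib (n + 3) : ℤ)) := by
    rw [norm_neg, norm_mul, norm_fibForm h0 h, Padic.norm_p_pow, ← zpow_add₀ (by positivity)]
    congr 1
    rw [h4, h3]; push_cast; ring
  have hlt : ‖fibForm ξ (n + 1)‖ < ‖-((p : ℚ_[p]) ^ Nat.fib (n + 1) * fibForm ξ n)‖ := by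
    rw [hn, norm_fibForm h0 h]
    apply zpow_lt_zpow_right₀ hp1
    omega
  rw [e, Padic.add_eq_max_of_ne hlt.ne', max_eq_left hlt.le, hn]

lemma fibNumer_ne_zero {n : ℕ} (hn : 2 ≤ n) : fibNumer p n ≠ 0 := by
  intro h
  apply not_sq_dvd_fibWordVal_succ (Fact.out : p.Prime).one_lt n
  have h2 : 2 ≤ Nat.fib (n + 1) := Nat.fib_mono (show 3 ≤ n + 1 by omega)
  rw [sub_eq_zero.1 h]
  exact Dvd.dvd.mul_right (pow_dvd_pow _ h2) _

lemma abs_fibNumer_le (n : ℕ) : |fibNumer p n| ≤ (p : ℤ) ^ Nat.fib (n + 3) := by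
  have hp := (Fact.out : p.Prime).one_lt
  have h3 : Nat.fib (n + 3) = Nat.fib (n + 1) + Nat.fib (n + 2) := Nat.fib_add_two
  obtain ⟨a0, a1⟩ := fibWordVal_nonneg_and_lt hp n
  obtain ⟨b0, b1⟩ := fibWordVal_nonneg_and_lt hp (n + 1)
  have hq : (0 : ℤ) ≤ (p : ℤ) ^ Nat.fib (n + 1) := by positivity
  have h1 := mul_nonneg hq a0
  have h2 : (p : ℤ) ^ Nat.fib (n + 1) * fibWordVal p n ≤ (p : ℤ) ^ Nat.fib (n + 3) := by
    rw [h3, pow_add]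
    exact mul_le_mul_of_nonneg_left (by omega) hq
  rw [show n + 1 + 2 = n + 3 from rfl] at b1
  rw [fibNumer, abs_le]
  constructor <;> linarith

lemma one_sub_pow_ne_zero_of_pos {k : ℕ} (hk : 0 < k) : (1 : ℤ) - (p : ℤ) ^ k ≠ 0 := by
  have hp : (1 : ℤ) < p := by exact_mod_cast (Fact.out : p.Prime).one_lt
  have := one_lt_pow₀ hp hk.ne'
  omega

lemma abs_one_sub_pow_le (k : ℕ) : |(1 : ℤ) - (p : ℤ) ^ k| ≤ (p : ℤ) ^ k := by
  have hp : (1 : ℤ) ≤ p := by exact_mod_cast (Fact.out : p.Prime).one_lt.le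
  have := one_le_pow₀ (n := k) hp
  rw [abs_le]; constructor <;> omega

lemma uniform_witness {ξ : ℚ_[p]} {a b : ℤ} {N : ℕ} {e : ℤ} {x μ : ℝ} (ha : a ≠ 0) (hb : b ≠ 0)
    (hab : |a * b| ≤ (p : ℤ) ^ N) (hN : (N : ℝ) ≤ 2 * x)
    (hnorm : ‖(b : ℚ_[p]) * ξ - (a : ℚ_[p])‖ = (p : ℝ) ^ e) (he : (e : ℝ) ≤ x * -μ) :
    0 < ((|a * b| : ℤ) : ℝ) ^ (1 / 2 : ℝ) ∧
      ((|a * b| : ℤ) : ℝ) ^ (1 / 2 : ℝ) ≤ (p : ℝ) ^ x ∧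
      ‖(b : ℚ_[p]) * ξ - (a : ℚ_[p])‖ ≤ ((p : ℝ) ^ x) ^ (-μ) := by
  have hp1 : (1 : ℝ) < p := one_lt_prime_cast
  have hpos : (0 : ℝ) < ((|a * b| : ℤ) : ℝ) := by
    exact_mod_cast abs_pos.2 (mul_ne_zero ha hb)
  refine ⟨Real.rpow_pos_of_pos hpos _, ?_, ?_⟩
  · have h1 : ((|a * b| : ℤ) : ℝ) ≤ (p : ℝ) ^ (N : ℝ) := by
      rw [Real.rpow_natCast]; exact_mod_cast hab
    refine (Real.rpow_le_rpow hpos.le h1 (by norm_num)).trans ?_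
    rw [← Real.rpow_mul (by positivity)]
    exact Real.rpow_le_rpow_of_exponent_le hp1.le (by linarith)
  · rw [hnorm, ← Real.rpow_mul (by positivity), ← Real.rpow_intCast]
    exact Real.rpow_le_rpow_of_exponent_le hp1.le he

end Approximation

lemma exists_forall_le_linear_fib {α β : ℝ} (h : 0 < α + β * Real.goldenRatio) (C : ℝ) :
    ∃ M : ℕ, ∀ n ≥ M, C ≤ α * Nat.fib (n + 1) + β * Nat.fib (n + 2) := by
  obtain ⟨K, hK⟩ := exists_nat_ge ((C + |β|) / (α + β * Real.goldenRatio))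
  refine ⟨K + 4, fun n hn => ?_⟩
  have h1 : n + 1 ≤ Nat.fib (n + 1) := Nat.le_fib_self (by omega)
  have h2 : (K : ℝ) ≤ Nat.fib (n + 1) := by exact_mod_cast (by omega : K ≤ Nat.fib (n + 1))
  have h3 := (div_le_iff₀ h).1 (hK.trans h2)
  have h4 := Real.fib_succ_sub_goldenRatio_mul_fib (n + 1)
  have h5 : |β * Real.goldenConj ^ (n + 1)| ≤ |β| := by
    rw [abs_mul, abs_pow]
    refine mul_le_of_le_one_right (abs_nonneg _) (pow_le_one₀ (abs_nonneg _) ?_)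
    rw [abs_le]
    constructor <;> linarith [Real.neg_one_lt_goldenConj, Real.goldenConj_neg]
  have h6 := (abs_le.1 h5).1
  have h7 : α * Nat.fib (n + 1) + β * Nat.fib (n + 2)
      = (Nat.fib (n + 1) : ℝ) * (α + β * Real.goldenRatio) + β * Real.goldenConj ^ (n + 1) := by
    rw [← h4]; ring
  linarith

lemma exists_fib_le_lt {M : ℕ} {x : ℝ} (hx : (Nat.fib (M + 2) : ℝ) ≤ x) :
    ∃ n ≥ M, (Nat.fib (n + 2) : ℝ) ≤ x ∧ x < Nat.fib (n + 3) := by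
  have hex : ∃ k, x < Nat.fib k := by
    obtain ⟨K, hK⟩ := exists_nat_gt x
    have : K + 5 ≤ Nat.fib (K + 5) := Nat.le_fib_self (by omega)
    have : (K : ℝ) ≤ Nat.fib (K + 5) := by exact_mod_cast (by omega : K ≤ Nat.fib (K + 5))
    exact ⟨K + 5, hK.trans_le this⟩
  classical
  have hspec := Nat.find_spec hex
  have hk : M + 2 < Nat.find hex := by
    by_contra! hle
    have : (Nat.fib (Nat.find hex) : ℝ) ≤ Nat.fib (M + 2) := by exact_mod_cast Nat.fib_mono hle
    linarith
  obtain ⟨n, hn⟩ : ∃ n, Nat.find hex = n + 3 := ⟨Nat.find hex - 3, by omega⟩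
  refine ⟨n, by omega, not_lt.1 (Nat.find_min hex (by omega)), hn ▸ hspec⟩

lemma EReal.coe_le_of_forall_btwn {a c : ℝ} {s : EReal} (hac : a < c)
    (h : ∀ μ : ℝ, a < μ → μ < c → (μ : EReal) ≤ s) : (c : EReal) ≤ s := by
  by_contra! hs
  obtain ⟨y, hy1, hy2⟩ := EReal.lt_iff_exists_real_btwn.1 hs
  have hyc : y < c := EReal.coe_lt_coe_iff.1 hy2
  obtain ⟨z, hz1, hz2⟩ := exists_between (max_lt hac hyc)
  have := h z ((le_max_left _ _).trans_lt hz1) hz2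
  have h2 : (y : EReal) < z := EReal.coe_lt_coe_iff.2 ((le_max_right _ _).trans_lt hz1)
  exact absurd (hy1.trans h2) (not_lt.2 this)

section Exponents

variable {p : ℕ} [Fact p.Prime]

lemma le_multIrrExp_of_fibWordVal {ξ : ℚ_[p]} (h0 : ‖ξ‖ ≤ 1)
    (h : ∀ n, ‖ξ - fibWordVal p n‖ ≤ (p : ℝ) ^ (-(Nat.fib (n + 2) : ℤ))) {μ : ℝ} (hμ0 : 0 < μ)
    (hμ : μ < Real.goldenRatio ^ 2 + 1 / (1 + Real.goldenRatio ^ 2)) :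
    (μ : EReal) ≤ multIrrExp p ξ := by
  have hp1 : (1 : ℝ) < p := one_lt_prime_cast
  have hφ := Real.goldenRatio_sq
  have hφ1 := Real.one_lt_goldenRatio
  set φ := Real.goldenRatio with hφdef
  have hμ' : μ * (φ + 2) < 4 * (φ + 1) := by
    have : φ ^ 2 + 1 / (1 + φ ^ 2) = 4 * (φ + 1) / (φ + 2) := by
      rw [hφ]; field_simp; nlinarith
    rw [this, lt_div_iff₀ (by linarith)] at hμ
    exact hμ
  obtain ⟨M, hM⟩ := exists_forall_le_linear_fib (α := 2 - μ) (β := 2 - μ / 2)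
    (by rw [← hφdef]; nlinarith) 2
  refine le_sSup ⟨μ, rfl, ?_⟩
  refine Set.infinite_of_injective_forall_mem
    (f := fun k : ℕ => (fibNumer p (k + (M + 2)), 1 - (p : ℤ) ^ Nat.fib (k + (M + 2) + 1)))
    (fun k l hkl => ?_) fun k => ?_
  · have h1 : (p : ℤ) ^ Nat.fib (k + (M + 2) + 1) = (p : ℤ) ^ Nat.fib (l + (M + 2) + 1) := by
      have := (Prod.mk.inj hkl).2
      linarith
    have h2 := Int.pow_right_injective (by exact_mod_cast (Fact.out : p.Prime).two_le) h1
    have h3 := Nat.fib_add_two_strictMono.injective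
      (show Nat.fib (k + M + 1 + 2) = Nat.fib (l + M + 1 + 2) from h2)
    omega
  · set n := k + (M + 2) with hn
    have hb0 : 0 < Nat.fib (n + 1) := Nat.fib_pos.2 (by omega)
    have ha := fibNumer_ne_zero (p := p) (show 2 ≤ n by omega)
    have hb := one_sub_pow_ne_zero_of_pos (p := p) hb0
    have hnorm := norm_fibNumer_approx h0 h n
    have hlin := hM n (by omega)
    have h3 : (Nat.fib (n + 3) : ℝ) = Nat.fib (n + 1) + Nat.fib (n + 2) := by
      exact_mod_cast (Nat.fib_add_two : Nat.fib (n + 1 + 2) = _)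
    have hpos : (0 : ℝ) < ((|fibNumer p n * (1 - (p : ℤ) ^ Nat.fib (n + 1))| : ℤ) : ℝ) := by
      exact_mod_cast abs_pos.2 (mul_ne_zero ha hb)
    have habs : ((|fibNumer p n * (1 - (p : ℤ) ^ Nat.fib (n + 1))| : ℤ) : ℝ)
        ≤ (p : ℝ) ^ ((Nat.fib (n + 3) : ℝ) + Nat.fib (n + 1)) := by
      rw [Real.rpow_add (by positivity), Real.rpow_natCast, Real.rpow_natCast, abs_mul]
      exact_mod_cast mul_le_mul (abs_fibNumer_le n) (abs_one_sub_pow_le _) (abs_nonneg _)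
        (by positivity)
    simp only [Set.mem_ofPred_eq]
    push_cast at hnorm hpos habs ⊢
    rw [hnorm]
    refine ⟨by positivity, ?_⟩
    refine le_trans ?_ (Real.rpow_le_rpow_of_nonpos hpos habs (by linarith))
    rw [← Real.rpow_mul (by positivity), ← Real.rpow_intCast]
    apply Real.rpow_le_rpow_of_exponent_le hp1.le
    push_cast
    rw [h3]
    linarith

lemma le_uniformMultIrrExp_of_fibWordVal {ξ : ℚ_[p]} (h0 : ‖ξ‖ ≤ 1)
    (h : ∀ n, ‖ξ - fibWordVal p n‖ ≤ (p : ℝ) ^ (-(Nat.fib (n + 2) : ℤ))) {μ : ℝ} (hμ1 : 1 < μ)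
    (hμ : μ < 2 + 1 / (2 * Real.goldenRatio)) :
    (μ : EReal) ≤ uniformMultIrrExp p ξ := by
  have hp1 : (1 : ℝ) < p := one_lt_prime_cast
  have hφ := Real.goldenRatio_sq
  have hφ1 := Real.one_lt_goldenRatio
  set φ := Real.goldenRatio with hφdef
  have hμ' : 2 * μ < 3 + φ := by
    have : 2 + 1 / (2 * φ) = (3 + φ) / 2 := by
      field_simp; nlinarith
    linarith
  obtain ⟨M₁, hM₁⟩ := exists_forall_le_linear_fib (α := 1 - μ) (β := 2 - μ / 2)
    (by rw [← hφdef]; nlinarith) 2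
  obtain ⟨M₂, hM₂⟩ := exists_forall_le_linear_fib (α := 2 - μ) (β := 5 / 2 - μ)
    (by rw [← hφdef]; nlinarith) 3
  refine le_sSup ⟨μ, rfl, ?_⟩
  filter_upwards [eventually_ge_atTop ((p : ℝ) ^ Nat.fib (max M₁ M₂ + 2 + 2))] with X hX
  have hX0 : 0 < X := lt_of_lt_of_le (by positivity) hX
  obtain ⟨x, rfl⟩ : ∃ x : ℝ, (p : ℝ) ^ x = X :=
    ⟨Real.logb p X, Real.rpow_logb (by positivity) hp1.ne' hX0⟩
  rw [← Real.rpow_natCast, Real.rpow_le_rpow_left_iff hp1] at hX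
  obtain ⟨n, hn, hxl, hxu⟩ := exists_fib_le_lt hX
  have hb1 : 0 < Nat.fib (n + 1) := Nat.fib_pos.2 (by omega)
  have hb2 : 0 < Nat.fib (n + 2) := Nat.fib_pos.2 (by omega)
  have h3 : (Nat.fib (n + 3) : ℝ) = Nat.fib (n + 1) + Nat.fib (n + 2) := by
    exact_mod_cast (Nat.fib_add_two : Nat.fib (n + 1 + 2) = _)
  have h4 : (Nat.fib (n + 4) : ℝ) = Nat.fib (n + 2) + Nat.fib (n + 3) := by
    exact_mod_cast (Nat.fib_add_two : Nat.fib (n + 2 + 2) = _)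
  have hl₁ := hM₁ n (by omega)
  have hl₂ := hM₂ n (by omega)
  rcases lt_or_ge x (((Nat.fib (n + 3) : ℝ) + Nat.fib (n + 1)) / 2) with hx | hx
  · refine ⟨fibWordVal p n, 1 - (p : ℤ) ^ Nat.fib (n + 2),
      uniform_witness (N := Nat.fib (n + 2) + Nat.fib (n + 2)) (e := 2 - (Nat.fib (n + 4) : ℤ))
      ?_ (one_sub_pow_ne_zero_of_pos hb2) ?_ (by push_cast; linarith) ?_ ?_⟩
    · obtain ⟨m, rfl⟩ : ∃ m, n = m + 1 := ⟨n - 1, by omega⟩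
      exact fibWordVal_succ_ne_zero (Fact.out : p.Prime).one_lt m
    · obtain ⟨a0, a1⟩ := fibWordVal_nonneg_and_lt (Fact.out : p.Prime).one_lt n
      rw [abs_mul, pow_add, abs_of_nonneg a0]
      exact mul_le_mul (by omega) (abs_one_sub_pow_le _) (abs_nonneg _) (by positivity)
    · rw [← norm_fibForm h0 h n, fibForm]
      push_cast
      rfl
    · push_cast
      have := mul_lt_mul_of_pos_left hx (by linarith : (0 : ℝ) < μ)
      rw [h4]
      rw [h3] at this ⊢
      linarith
  · set k := ⌊x - ((Nat.fib (n + 3) : ℝ) + Nat.fib (n + 1)) / 2⌋₊ with hk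
    have hk1 := Nat.floor_le (sub_nonneg.2 hx)
    have hk2 := Nat.lt_floor_add_one (x - ((Nat.fib (n + 3) : ℝ) + Nat.fib (n + 1)) / 2)
    rw [← hk] at hk1 hk2
    have hpk : (p : ℤ) ^ k ≠ 0 := pow_ne_zero _ (by exact_mod_cast (Fact.out : p.Prime).ne_zero)
    refine ⟨(p : ℤ) ^ k * fibNumer p n, (p : ℤ) ^ k * (1 - (p : ℤ) ^ Nat.fib (n + 1)),
      uniform_witness (N := (k + Nat.fib (n + 3)) + (k + Nat.fib (n + 1)))
      (e := -(k : ℤ) + (2 - 2 * (Nat.fib (n + 3) : ℤ)))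
      (mul_ne_zero hpk (fibNumer_ne_zero (by omega)))
      (mul_ne_zero hpk (one_sub_pow_ne_zero_of_pos hb1)) ?_ (by push_cast; linarith) ?_ ?_⟩
    · have hpk0 : (0 : ℤ) ≤ (p : ℤ) ^ k := by positivity
      rw [abs_mul, abs_mul, abs_mul, pow_add, pow_add, pow_add, abs_of_nonneg hpk0]
      exact mul_le_mul (mul_le_mul_of_nonneg_left (abs_fibNumer_le n) hpk0)
        (mul_le_mul_of_nonneg_left (abs_one_sub_pow_le _) hpk0) (by positivity) (by positivity)
    · rw [zpow_add₀ (by positivity), ← norm_fibNumer_approx h0 h n, ← Padic.norm_p_pow,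
        ← norm_mul]
      push_cast
      congr 1
      ring
    · push_cast
      have := mul_lt_mul_of_pos_left hxu (by linarith : (0 : ℝ) < μ - 1)
      rw [h3] at this hk2 ⊢
      linarith

end Exponents

lemma length_and_ofDigits_fibWord (p : ℕ) {w : ℕ → List ℕ} (hw1 : w 1 = [0]) (hw2 : w 2 = [0, 1])
    (hwrec : ∀ n : ℕ, 1 ≤ n → w (n + 2) = w (n + 1) ++ w n) (n : ℕ) :
    (w (n + 1)).length = Nat.fib (n + 2) ∧ ((Nat.ofDigits p (w (n + 1)) : ℕ) : ℤ) = fibWordVal p n := by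
  induction n using Nat.twoStepInduction with
  | zero => simp [hw1, fibWordVal]
  | one => simp [hw2, fibWordVal, Nat.ofDigits, show Nat.fib 3 = 2 from rfl]
  | more n ih1 ih2 =>
    rw [hwrec (n + 1) (by omega), List.length_append, Nat.ofDigits_append]
    have hf : Nat.fib (n + 2 + 2) = Nat.fib (n + 2) + Nat.fib (n + 3) := Nat.fib_add_two
    refine ⟨by rw [ih1.1, ih2.1, hf, add_comm], ?_⟩
    rw [Nat.cast_add, Nat.cast_mul, Nat.cast_pow, ih1.2, ih2.2, ih2.1]
    simp only [fibWordVal]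

theorem fib_multIrrExp_bounds (p : ℕ) [Fact p.Prime]
    (w : ℕ → List ℕ) (hw1 : w 1 = [0]) (hw2 : w 2 = [0, 1])
    (hwrec : ∀ n : ℕ, 1 ≤ n → w (n + 2) = w (n + 1) ++ w n)
    (f : ℕ → ℕ)
    (hf : ∀ n j : ℕ, 1 ≤ j → j ≤ (w n).length → f j = (w n).getD (j - 1) 0)
    (ξ : ℚ_[p]) (hξ : ξ = ∑' n : ℕ, (f (n + 1) : ℚ_[p]) * (p : ℚ_[p]) ^ n)
    (γ : ℝ) (hγ : γ = (1 + Real.sqrt 5) / 2) :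
    ((γ ^ 2 + 1 / (1 + γ ^ 2) : ℝ) : EReal) ≤ multIrrExp p ξ ∧
    ((2 + 1 / (2 * γ) : ℝ) : EReal) ≤ uniformMultIrrExp p ξ := by
  have hsum := fun k => padicNorm_tsum_sub_sum_range_le (p := p) (fun n => f (n + 1)) k
  rw [← hξ] at hsum
  have h0 : ‖ξ‖ ≤ 1 := by simpa using hsum 0
  have h : ∀ n, ‖ξ - fibWordVal p n‖ ≤ (p : ℝ) ^ (-(Nat.fib (n + 2) : ℤ)) := fun n => by
    obtain ⟨hl, hd⟩ := length_and_ofDigits_fibWord p hw1 hw2 hwrec n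
    have hs : (fibWordVal p n : ℚ_[p])
        = ∑ i ∈ Finset.range (Nat.fib (n + 2)), (f (i + 1) : ℚ_[p]) * (p : ℚ_[p]) ^ i := by
      rw [← hd, Nat.ofDigits_eq_sum_getD, hl]
      push_cast
      refine Finset.sum_congr rfl fun i hi => ?_
      rw [hf (n + 1) (i + 1) (by omega) (by rw [hl]; exact Finset.mem_range.1 hi),
        Nat.add_sub_cancel]
    rw [hs]
    exact hsum _
  obtain rfl : γ = Real.goldenRatio := hγ
  have hφ := Real.one_lt_goldenRatio
  constructor
  · refine EReal.coe_le_of_forall_btwn (a := 0) (by positivity) fun μ h1 h2 => ?_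
    exact le_multIrrExp_of_fibWordVal h0 h h1 h2
  · refine EReal.coe_le_of_forall_btwn (a := 1) ?_ fun μ h1 h2 => ?_
    · have : 0 < 1 / (2 * Real.goldenRatio) := by positivity
      linarith
    · exact le_uniformMultIrrExp_of_fibWordVal h0 h h1 h2
end
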